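/- Let K be a field, let t, m, n be integers with 1 ≤ t ≤ m ≤ n, let X be a generic m×n matrix over K, and set I = I_t(X) in the polynomial ring K[X]. Suppose none of the following holds: (i) t = 1; (ii) t = m = n; (iii) m = n and t = n−1; (iv) n = m+1 and t = m; (v) n = m+2 and t = m; (vi) m = 2, n = 5, and t = 2. If 3 ≤ t = m and n = m+3, then I satisfies G_18 but does not satisfy G_19. In all other cases, I satisfies G_{(m−t+2)(n−t+2)} but does not satisfy G_{(m−t+2)(n−t+2)+1}. -/

import Mathlib

open Matrix

/-- The ideal generated by the `t × t` minors of a matrix. -/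
noncomputable def minorsIdeal {R : Type*} [CommRing R] {α β : Type*}
    (t : ℕ) (A : Matrix α β R) : Ideal R :=
  Ideal.span {d : R | ∃ (f : Fin t → α) (g : Fin t → β),
    Function.Injective f ∧ Function.Injective g ∧ d = (A.submatrix f g).det}

/-- The height of an ideal: the infimum of the heights of primes containing it. -/
noncomputable def idealHeight {R : Type*} [CommRing R] (I : Ideal R) : ℕ∞ :=
  ⨅ p ∈ {p : PrimeSpectrum R | I ≤ p.asIdeal}, Order.height p

/-- The minimal number of generators of an ideal. -/
noncomputable def mu {R : Type*} [CommRing R] (I : Ideal R) : ℕ :=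
  sInf {n : ℕ | ∃ s : Finset R, s.card = n ∧ Ideal.span (s : Set R) = I}

/-- The condition `G_s`. -/
def SatisfiesG {R : Type*} [CommRing R] (I : Ideal R) (s : ℕ) : Prop :=
  ∀ (p : Ideal R) (hp : p.IsPrime), I ≤ p →
    haveI := hp
    ringKrullDim (Localization.AtPrime p) ≤ ((s - 1 : ℕ) : WithBot ℕ∞) →
    (mu (I.map (algebraMap R (Localization.AtPrime p))) : WithBot ℕ∞) ≤
      ringKrullDim (Localization.AtPrime p)

section Minors

variable {S : Type*} [CommRing S]

theorem det_mem_of_rows_fin (J : Ideal S) (k : ℕ) :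
    ∀ (s : ℕ) (M : Matrix (Fin s) (Fin s) S) (A : Finset (Fin s)), k + A.card ≤ s →
      (∀ f g : Fin k → Fin s, Function.Injective f → Function.Injective g → (∀ u, f u ∉ A) →
        (M.submatrix f g).det ∈ J) → M.det ∈ J := by
  intro s
  induction s with
  | zero =>
    intro M A hA h
    obtain rfl : k = 0 := by omega
    simpa using h id id Function.injective_id Function.injective_id (fun u => u.elim0)
  | succ s ih =>
    intro M A hA h
    by_cases hk : k = s + 1
    · subst hk
      have hA0 : A = ∅ := by
        rw [← Finset.card_eq_zero]; omega
      simpa using h id id Function.injective_id Function.injective_id (by simp [hA0])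
    obtain ⟨i, hi⟩ : ∃ i : Fin (s + 1), A.Nonempty → i ∈ A := by
      by_cases hne : A.Nonempty
      · exact ⟨hne.choose, fun _ => hne.choose_spec⟩
      · exact ⟨0, fun h => absurd h hne⟩
    rw [Matrix.det_succ_row M i]
    refine Ideal.sum_mem _ fun j _ => Ideal.mul_mem_left _ _ ?_
    refine ih _ (A.preimage i.succAbove Fin.succAbove_right_injective.injOn) ?_ ?_
    · rcases A.eq_empty_or_nonempty with rfl | hne
      · simp only [Finset.preimage_empty, Finset.card_empty] at hA ⊢
        omega
      · have hsub : (A.preimage i.succAbove Fin.succAbove_right_injective.injOn).image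
            i.succAbove ⊆ A.erase i := by
          intro x hx
          simp only [Finset.mem_image, Finset.mem_preimage] at hx
          obtain ⟨y, hy, rfl⟩ := hx
          exact Finset.mem_erase.2 ⟨Fin.succAbove_ne _ _, hy⟩
        have hc := Finset.card_le_card hsub
        rw [Finset.card_image_of_injective _ Fin.succAbove_right_injective,
          Finset.card_erase_of_mem (hi hne)] at hc
        have := hne.card_pos
        omega
    · intro f g hf hg hfA
      rw [Matrix.submatrix_submatrix]
      exact h _ _ (Fin.succAbove_right_injective.comp hf) (Fin.succAbove_right_injective.comp hg)
        (fun u hu => hfA u (by simpa using hu))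

/-- Laplace expansion along a set `A` of rows. -/
theorem det_mem_of_rows {ι : Type*} [Fintype ι] [DecidableEq ι] (J : Ideal S) (k : ℕ)
    (M : Matrix ι ι S) (A : Finset ι) (hA : k + A.card ≤ Fintype.card ι)
    (h : ∀ f g : Fin k → ι, Function.Injective f → Function.Injective g → (∀ u, f u ∉ A) →
        (M.submatrix f g).det ∈ J) : M.det ∈ J := by
  let e := Fintype.equivFin ι
  rw [← Matrix.det_submatrix_equiv_self e.symm M]
  refine det_mem_of_rows_fin J k _ _ (A.map e.toEmbedding) (by simpa using hA) ?_
  intro f g hf hg hfA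
  rw [Matrix.submatrix_submatrix]
  refine h _ _ (e.symm.injective.comp hf) (e.symm.injective.comp hg) fun u hu => hfA u ?_
  rw [Finset.mem_map_equiv]
  exact hu

theorem det_mem_of_cols {ι : Type*} [Fintype ι] [DecidableEq ι] (J : Ideal S) (k : ℕ)
    (M : Matrix ι ι S) (A : Finset ι) (hA : k + A.card ≤ Fintype.card ι)
    (h : ∀ f g : Fin k → ι, Function.Injective f → Function.Injective g → (∀ u, g u ∉ A) →
        (M.submatrix f g).det ∈ J) : M.det ∈ J := by
  rw [← Matrix.det_transpose]
  refine det_mem_of_rows J k _ A hA fun f g hf hg hA => ?_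
  rw [← Matrix.transpose_submatrix, Matrix.det_transpose]
  exact h g f hg hf hA

variable {α β : Type*}

theorem det_submatrix_mem_minorsIdeal {k : ℕ} (Y : Matrix α β S) {f : Fin k → α} {g : Fin k → β}
    (hf : Function.Injective f) (hg : Function.Injective g) :
    (Y.submatrix f g).det ∈ minorsIdeal k Y :=
  Ideal.subset_span ⟨f, g, hf, hg, rfl⟩

theorem det_submatrix_eq_zero_of_not_injective {ι : Type*} [Fintype ι] [DecidableEq ι]
    (Y : Matrix α β S) {f : ι → α} {g : ι → β}
    (h : ¬ (Function.Injective f ∧ Function.Injective g)) : (Y.submatrix f g).det = 0 := by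
  by_cases hf : Function.Injective f
  · have hg : ¬ Function.Injective g := fun hg => h ⟨hf, hg⟩
    simp only [Function.Injective, not_forall] at hg
    obtain ⟨a, b, hab, hne⟩ := hg
    exact Matrix.det_zero_of_column_eq hne (fun i => by simp [hab])
  · simp only [Function.Injective, not_forall] at hf
    obtain ⟨a, b, hab, hne⟩ := hf
    exact Matrix.det_zero_of_row_eq hne (by ext i; simp [hab])

theorem minorsIdeal_map {T : Type*} [CommRing T] (φ : S →+* T) (k : ℕ) (A : Matrix α β S) :
    (minorsIdeal k A).map φ = minorsIdeal k (A.map φ) := by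
  rw [minorsIdeal, minorsIdeal, Ideal.map_span]
  congr 1
  ext d
  constructor
  · rintro ⟨_, ⟨f, g, hf, hg, rfl⟩, rfl⟩
    exact ⟨f, g, hf, hg, by rw [RingHom.map_det]; rfl⟩
  · rintro ⟨f, g, hf, hg, rfl⟩
    exact ⟨_, ⟨f, g, hf, hg, rfl⟩, by rw [RingHom.map_det]; rfl⟩

/-- Adding a matrix that factors through rank `r` turns `(r + k)`-minors into combinations of
`k`-minors. -/
theorem det_add_mul_mem_minorsIdeal {r k t : ℕ} (ht : r + k ≤ t) (Y : Matrix (Fin t) (Fin t) S)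
    (U : Matrix (Fin t) (Fin r) S) (V : Matrix (Fin r) (Fin t) S) :
    (Y + U * V).det ∈ minorsIdeal k Y := by
  have hdet : (Y + U * V).det = (Matrix.fromBlocks 1 V (-U) Y).det := by
    rw [Matrix.det_fromBlocks_one₁₁]
    simp
  rw [hdet]
  let L : Finset (Fin r ⊕ Fin t) := Finset.univ.map Function.Embedding.inl
  have hL : L.card = r := by simp [L]
  have hmem : ∀ x, x ∉ L → ∃ y, x = Sum.inr y := by
    rintro (x | x) hx
    · exact absurd (by simp [L]) hx
    · exact ⟨x, rfl⟩
  refine det_mem_of_rows _ t _ L (by simp [hL, add_comm]) fun f g hf hg hfL => ?_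
  have hc : (Finset.univ.filter fun u => g u ∈ L).card ≤ r := by
    exact (Finset.card_le_card_of_injOn g (fun u hu => by simpa using hu) hg.injOn).trans hL.le
  refine det_mem_of_cols _ k _ (Finset.univ.filter fun u => g u ∈ L)
    (by simp only [Fintype.card_fin]; omega) fun f' g' hf' hg' hL' => ?_
  choose a ha using fun u => hmem _ (hfL (f' u))
  choose b hb using fun u => hmem (g (g' u)) (by simpa using hL' u)
  have : (((Matrix.fromBlocks 1 V (-U) Y).submatrix f g).submatrix f' g') = Y.submatrix a b := by
    ext i j
    simp [ha, hb]
  rw [this]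
  refine det_submatrix_mem_minorsIdeal Y (fun i j hij => hf' (hf ?_)) (fun i j hij => hg' (hg ?_))
  · rw [ha, ha, hij]
  · rw [hb, hb, hij]

variable {r : ℕ}

/-- The skeleton `A[:,e'] * A[e,e']⁻¹ * A[e,:]` of a matrix with respect to chosen rows and columns;
it agrees with `A` on those rows and columns and has rank at most `r`. -/
noncomputable def skeleton (A : Matrix α β S) (e : Fin r → α) (e' : Fin r → β) : Matrix α β S :=
  A.submatrix id e' * (A.submatrix e e')⁻¹ * A.submatrix e id

theorem skeleton_apply_row (A : Matrix α β S) (e : Fin r → α) (e' : Fin r → β)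
    (h : IsUnit (A.submatrix e e').det) (i : Fin r) (j : β) :
    skeleton A e e' (e i) j = A (e i) j := by
  have : (skeleton A e e').submatrix e id = A.submatrix e id := by
    rw [skeleton, Matrix.submatrix_mul _ _ e id id Function.bijective_id,
      Matrix.submatrix_mul _ _ e id id Function.bijective_id]
    simp only [Matrix.submatrix_submatrix, Function.comp_id, Function.id_comp,
      Matrix.submatrix_id_id]
    rw [Matrix.mul_nonsing_inv _ h, Matrix.one_mul]
  exact congrFun (congrFun this i) j

theorem skeleton_apply_col (A : Matrix α β S) (e : Fin r → α) (e' : Fin r → β)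
    (h : IsUnit (A.submatrix e e').det) (i : α) (j : Fin r) :
    skeleton A e e' i (e' j) = A i (e' j) := by
  have : (skeleton A e e').submatrix id e' = A.submatrix id e' := by
    rw [skeleton, Matrix.mul_assoc, Matrix.submatrix_mul _ _ id id e' Function.bijective_id,
      Matrix.submatrix_mul _ _ id id e' Function.bijective_id]
    simp only [Matrix.submatrix_submatrix, Function.comp_id, Function.id_comp,
      Matrix.submatrix_id_id]
    rw [Matrix.nonsing_inv_mul _ h, Matrix.mul_one]
  exact congrFun (congrFun this i) j

theorem skeleton_congr {A B : Matrix α β S} {e : Fin r → α} {e' : Fin r → β}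
    (hrow : ∀ i j, A (e i) j = B (e i) j) (hcol : ∀ i j, A i (e' j) = B i (e' j)) :
    skeleton A e e' = skeleton B e e' := by
  have h1 : A.submatrix id e' = B.submatrix id e' := by ext i j; exact hcol i j
  have h2 : A.submatrix e id = B.submatrix e id := by ext i j; exact hrow i j
  have h3 : A.submatrix e e' = B.submatrix e e' := by ext i j; exact hrow i _
  rw [skeleton, skeleton, h1, h2, h3]

theorem skeleton_map {T : Type*} [CommRing T] (φ : S →+* T) (A : Matrix α β S) (e : Fin r → α)
    (e' : Fin r → β) (h : IsUnit (A.submatrix e e').det) :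
    (skeleton A e e').map φ = skeleton (A.map φ) e e' := by
  have hinv : ((A.submatrix e e')⁻¹).map φ = ((A.submatrix e e').map φ)⁻¹ := by
    symm
    apply Matrix.inv_eq_right_inv
    rw [← Matrix.map_mul, Matrix.mul_nonsing_inv _ h, Matrix.map_one _ (map_zero φ) (map_one φ)]
  rw [skeleton, Matrix.map_mul, Matrix.map_mul, hinv]
  rfl

theorem det_submatrix_sumElim {ι : Type*} [Fintype ι] [DecidableEq ι] (A : Matrix α β S)
    (e : Fin r → α) (e' : Fin r → β)
    (h : IsUnit (A.submatrix e e').det) (f : ι → α) (g : ι → β) :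
    (A.submatrix (Sum.elim e f) (Sum.elim e' g)).det =
      (A.submatrix e e').det * ((A - skeleton A e e').submatrix f g).det := by
  let _ := Matrix.invertibleOfIsUnitDet _ h
  have hb : A.submatrix (Sum.elim e f) (Sum.elim e' g) = Matrix.fromBlocks (A.submatrix e e')
      (A.submatrix e g) (A.submatrix f e') (A.submatrix f g) := by
    ext (i | i) (j | j) <;> rfl
  rw [hb, Matrix.det_fromBlocks₁₁, Matrix.invOf_eq_nonsing_inv]
  rfl

theorem minorsIdeal_eq_of_isUnit (A : Matrix α β S) (e : Fin r → α) (e' : Fin r → β)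
    (h : IsUnit (A.submatrix e e').det) (k : ℕ) :
    minorsIdeal (r + k) A = minorsIdeal k (A - skeleton A e e') := by
  apply le_antisymm
  · refine Ideal.span_le.2 ?_
    rintro _ ⟨f, g, hf, hg, rfl⟩
    have hA : A.submatrix f g = (A - skeleton A e e').submatrix f g +
        (A.submatrix f e' * (A.submatrix e e')⁻¹) * A.submatrix e g := by
      ext i j
      have : (A.submatrix f e' * (A.submatrix e e')⁻¹ * A.submatrix e g) i j =
        skeleton A e e' (f i) (g j) := rfl
      rw [Matrix.add_apply, this]
      simp
    rw [hA]
    have hle : minorsIdeal k ((A - skeleton A e e').submatrix f g) ≤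
        minorsIdeal k (A - skeleton A e e') := by
      refine Ideal.span_le.2 ?_
      rintro _ ⟨f', g', hf', hg', rfl⟩
      exact det_submatrix_mem_minorsIdeal _ (hf.comp hf') (hg.comp hg')
    exact hle (det_add_mul_mem_minorsIdeal le_rfl _ _ _)
  · refine Ideal.span_le.2 ?_
    rintro _ ⟨f, g, hf, hg, rfl⟩
    have h1 := det_submatrix_sumElim A e e' h f g
    have h2 : (A.submatrix (Sum.elim e f) (Sum.elim e' g)).det ∈ minorsIdeal (r + k) A := by
      rw [← Matrix.det_submatrix_equiv_self finSumFinEquiv.symm, Matrix.submatrix_submatrix]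
      by_cases hinj : Function.Injective (Sum.elim e f ∘ finSumFinEquiv.symm) ∧
        Function.Injective (Sum.elim e' g ∘ finSumFinEquiv.symm)
      · exact det_submatrix_mem_minorsIdeal _ hinj.1 hinj.2
      · rw [det_submatrix_eq_zero_of_not_injective _ hinj]
        exact zero_mem _
    rw [h1] at h2
    exact (Ideal.unit_mul_mem_iff_mem _ h).1 h2

/-- The index set of the `k`-element subsets avoiding the range of `e`. -/
abbrev avoidingSubsets {α : Type*} [Fintype α] [DecidableEq α] (e : Fin r → α) (k : ℕ) :
    Finset (Finset α) :=
  Finset.powersetCard k (Finset.univ.image e)ᶜ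

theorem card_avoidingSubsets [Fintype α] [DecidableEq α] {e : Fin r → α}
    (he : Function.Injective e) (k : ℕ) :
    (avoidingSubsets e k).card = (Fintype.card α - r).choose k := by
  rw [Finset.card_powersetCard, Finset.card_compl, Finset.card_image_of_injective _ he]
  simp

/-- The increasing enumeration of a subset in `avoidingSubsets e k`. -/
noncomputable def avoidingEmb [Fintype α] [LinearOrder α] {e : Fin r → α} {k : ℕ}
    (s : avoidingSubsets e k) : Fin k ↪o α :=
  s.1.orderEmbOfFin (Finset.mem_powersetCard.1 s.2).2

theorem avoidingEmb_mem [Fintype α] [LinearOrder α] {e : Fin r → α} {k : ℕ}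
    (s : avoidingSubsets e k) (u : Fin k) : avoidingEmb s u ∈ s.1 :=
  Finset.orderEmbOfFin_mem _ _ u

theorem range_avoidingEmb [Fintype α] [LinearOrder α] {e : Fin r → α} {k : ℕ}
    (s : avoidingSubsets e k) : Set.range (avoidingEmb s) = s.1 :=
  Finset.range_orderEmbOfFin _ _

theorem avoidingEmb_ne [Fintype α] [LinearOrder α] {e : Fin r → α} {k : ℕ}
    (s : avoidingSubsets e k) (u : Fin k) (i : Fin r) : avoidingEmb s u ≠ e i := by
  intro h
  have h1 := (Finset.mem_powersetCard.1 s.2).1 (avoidingEmb_mem s u)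
  simp [h] at h1

theorem exists_avoidingEmb_comp [Fintype α] [LinearOrder α] {e : Fin r → α} {k : ℕ}
    {f : Fin k → α} (hf : Function.Injective f) (h : ∀ u i, f u ≠ e i) :
    ∃ (s : avoidingSubsets e k) (σ : Equiv.Perm (Fin k)), f = avoidingEmb s ∘ σ := by
  have hs : Finset.univ.image f ∈ avoidingSubsets e k := by
    refine Finset.mem_powersetCard.2 ⟨fun x hx => ?_, ?_⟩
    · simp only [Finset.mem_image, Finset.mem_univ, true_and, Finset.mem_compl] at hx ⊢
      rintro ⟨i, rfl⟩
      obtain ⟨u, hu⟩ := hx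
      exact h u i hu
    · rw [Finset.card_image_of_injective _ hf, Finset.card_univ, Fintype.card_fin]
  refine ⟨⟨_, hs⟩, ?_⟩
  have hex : ∀ u, ∃ v, avoidingEmb (⟨_, hs⟩ : avoidingSubsets e k) v = f u := by
    intro u
    have : f u ∈ Set.range (avoidingEmb (⟨_, hs⟩ : avoidingSubsets e k)) := by
      rw [range_avoidingEmb]; simp
    exact this
  choose σ hσ using hex
  have hσi : Function.Injective σ := fun a b hab => hf (by rw [← hσ, ← hσ, hab])
  exact ⟨Equiv.ofBijective σ (Finite.injective_iff_bijective.1 hσi), by ext u; simp [hσ]⟩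

/-- The `k`-minors of a matrix vanishing on `r` rows and `r` columns are generated by the
increasing minors avoiding these rows and columns. -/
theorem minorsIdeal_eq_span_range [Fintype α] [LinearOrder α] [Fintype β] [LinearOrder β]
    (Y : Matrix α β S) (e : Fin r → α) (e' : Fin r → β) (k : ℕ)
    (hrow : ∀ i j, Y (e i) j = 0) (hcol : ∀ i j, Y i (e' j) = 0) :
    minorsIdeal k Y = Ideal.span (Set.range fun x : avoidingSubsets e k × avoidingSubsets e' k =>
      (Y.submatrix (avoidingEmb x.1) (avoidingEmb x.2)).det) := by
  apply le_antisymm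
  · refine Ideal.span_le.2 ?_
    rintro _ ⟨f, g, hf, hg, rfl⟩
    by_cases h1 : ∀ u i, f u ≠ e i
    · by_cases h2 : ∀ u i, g u ≠ e' i
      · obtain ⟨s, σ, rfl⟩ := exists_avoidingEmb_comp hf h1
        obtain ⟨s', σ', rfl⟩ := exists_avoidingEmb_comp hg h2
        have : Y.submatrix (avoidingEmb s ∘ σ) (avoidingEmb s' ∘ σ') =
          ((Y.submatrix (avoidingEmb s) (avoidingEmb s')).submatrix σ id).submatrix id σ' := rfl
        rw [this, Matrix.det_permute', Matrix.det_permute]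
        exact Ideal.mul_mem_left _ _ (Ideal.mul_mem_left _ _ (Ideal.subset_span ⟨(s, s'), rfl⟩))
      · push Not at h2
        obtain ⟨u, i, hui⟩ := h2
        rw [Matrix.det_eq_zero_of_column_eq_zero u (fun x => by simp [hui, hcol])]
        exact zero_mem _
    · push Not at h1
      obtain ⟨u, i, hui⟩ := h1
      rw [Matrix.det_eq_zero_of_row_eq_zero u (fun x => by simp [hui, hrow])]
      exact zero_mem _
  · refine Ideal.span_le.2 ?_
    rintro _ ⟨x, rfl⟩
    exact det_submatrix_mem_minorsIdeal _ (avoidingEmb x.1).injective (avoidingEmb x.2).injective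

theorem sub_skeleton_row (A : Matrix α β S) (e : Fin r → α) (e' : Fin r → β)
    (h : IsUnit (A.submatrix e e').det) (i : Fin r) (j : β) :
    (A - skeleton A e e') (e i) j = 0 := by
  rw [Matrix.sub_apply, skeleton_apply_row A e e' h, sub_self]

theorem sub_skeleton_col (A : Matrix α β S) (e : Fin r → α) (e' : Fin r → β)
    (h : IsUnit (A.submatrix e e').det) (i : α) (j : Fin r) :
    (A - skeleton A e e') i (e' j) = 0 := by
  rw [Matrix.sub_apply, skeleton_apply_col A e e' h, sub_self]

/-- If a chosen `r`-minor is a unit, the ideal of `(r + k)`-minors is generated by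
`(m - r).choose k * (n - r).choose k` elements. -/
theorem exists_finset_span_eq_minorsIdeal [Fintype α] [LinearOrder α] [Fintype β] [LinearOrder β]
    (A : Matrix α β S) {e : Fin r → α} {e' : Fin r → β} (he : Function.Injective e)
    (he' : Function.Injective e') (h : IsUnit (A.submatrix e e').det) (k : ℕ) :
    ∃ s : Finset S, s.card ≤ (Fintype.card α - r).choose k * (Fintype.card β - r).choose k ∧
      Ideal.span (s : Set S) = minorsIdeal (r + k) A := by
  classical
  refine ⟨Finset.univ.image fun x : avoidingSubsets e k × avoidingSubsets e' k =>
      ((A - skeleton A e e').submatrix (avoidingEmb x.1) (avoidingEmb x.2)).det, ?_, ?_⟩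
  · refine Finset.card_image_le.trans (le_of_eq ?_)
    rw [Finset.card_univ, Fintype.card_prod, Fintype.card_coe, Fintype.card_coe,
      card_avoidingSubsets he, card_avoidingSubsets he']
  · rw [minorsIdeal_eq_of_isUnit A e e' h, minorsIdeal_eq_span_range _ e e' k
      (sub_skeleton_row A e e' h) (sub_skeleton_col A e e' h)]
    simp

theorem mu_le_card (I : Ideal S) (s : Finset S) (h : Ideal.span (s : Set S) = I) :
    mu I ≤ s.card :=
  Nat.sInf_le ⟨s, rfl, h⟩

theorem exists_finset_card_eq_mu (I : Ideal S) (s : Finset S) (h : Ideal.span (s : Set S) = I) :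
    ∃ s' : Finset S, s'.card = mu I ∧ Ideal.span (s' : Set S) = I :=
  Nat.sInf_mem (s := {n : ℕ | ∃ s : Finset S, s.card = n ∧ Ideal.span (s : Set S) = I})
    ⟨_, s, rfl, h⟩

end Minors

section Generic

variable {K : Type*} [Field K] {α β : Type*}

variable (K α β) in
/-- The generic matrix. -/
noncomputable abbrev genericMatrix : Matrix α β (MvPolynomial (α × β) K) :=
  Matrix.of fun i j => MvPolynomial.X (i, j)

/-- The evaluation homomorphism at a matrix. -/
noncomputable abbrev evalAt {T : Type*} [CommRing T] [Algebra K T] (M : Matrix α β T) :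
    MvPolynomial (α × β) K →ₐ[K] T :=
  MvPolynomial.aeval fun x => M x.1 x.2

theorem genericMatrix_map_evalAt {T : Type*} [CommRing T] [Algebra K T] (M : Matrix α β T) :
    (genericMatrix K α β).map (evalAt M) = M := by
  ext i j
  simp

theorem evalAt_det {T : Type*} [CommRing T] [Algebra K T] (M : Matrix α β T) {ι : Type*}
    [Fintype ι] [DecidableEq ι] (f : ι → α) (g : ι → β) :
    evalAt M ((genericMatrix K α β).submatrix f g).det = (M.submatrix f g).det := by
  rw [AlgHom.map_det]
  congr 1
  ext i j
  simp

theorem evalAt_comp {T T' : Type*} [CommRing T] [Algebra K T] [CommRing T'] [Algebra K T']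
    (φ : T →ₐ[K] T') (M : Matrix α β T) (f : MvPolynomial (α × β) K) :
    evalAt (M.map φ) f = φ (evalAt M f) := by
  have : evalAt (M.map φ) = φ.comp (evalAt (K := K) M) := by
    apply MvPolynomial.algHom_ext
    intro i
    simp
  rw [this]
  rfl

theorem evalAt_map_algebraMap {T : Type*} [CommRing T] [Algebra K T]
    [Algebra (MvPolynomial (α × β) K) T] [IsScalarTower K (MvPolynomial (α × β) K) T]
    (f : MvPolynomial (α × β) K) :
    evalAt ((genericMatrix K α β).map (algebraMap _ T)) f = algebraMap _ T f := by
  have : evalAt ((genericMatrix K α β).map (algebraMap _ T)) =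
      IsScalarTower.toAlgHom K (MvPolynomial (α × β) K) T := by
    apply MvPolynomial.algHom_ext
    intro i
    simp
  rw [this]
  rfl

theorem det_genericMatrix_submatrix_ne_zero {ι : Type*} [Fintype ι] [DecidableEq ι] {f : ι → α}
    {g : ι → β} (hf : Function.Injective f) (hg : Function.Injective g) :
    ((genericMatrix K α β).submatrix f g).det ≠ 0 := by
  classical
  intro h
  let M : Matrix α β K := Matrix.of fun i j => if ∃ u, f u = i ∧ g u = j then 1 else 0
  have hM : M.submatrix f g = 1 := by
    ext i j
    simp only [M, Matrix.submatrix_apply, Matrix.of_apply, Matrix.one_apply]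
    congr 1
    refine propext ⟨?_, fun hij => ⟨i, rfl, by rw [hij]⟩⟩
    rintro ⟨u, h1, h2⟩
    rw [← hf h1, hg h2]
  have h2 := evalAt_det (K := K) M f g
  rw [h, hM] at h2
  simp at h2

variable {r : ℕ}

open Classical in
/-- Replace the entries of `M` at positions in `A` by those of its skeleton. -/
noncomputable def replaceBySkeleton {T : Type*} [CommRing T] (M : Matrix α β T) (e : Fin r → α)
    (e' : Fin r → β) (A : Set (α × β)) : Matrix α β T :=
  Matrix.of fun i j => if (i, j) ∈ A then skeleton M e e' i j else M i j

theorem replaceBySkeleton_univ {T : Type*} [CommRing T] (M : Matrix α β T) (e : Fin r → α)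
    (e' : Fin r → β) : replaceBySkeleton M e e' Set.univ = skeleton M e e' := by
  ext i j
  simp [replaceBySkeleton]

theorem replaceBySkeleton_eq_self {T : Type*} [CommRing T] {M : Matrix α β T} {e : Fin r → α}
    {e' : Fin r → β} (h : M - skeleton M e e' = 0) (A : Set (α × β)) :
    replaceBySkeleton M e e' A = M := by
  rw [sub_eq_zero] at h
  ext i j
  simp [replaceBySkeleton, ← h]

theorem replaceBySkeleton_map {T T' : Type*} [CommRing T] [CommRing T'] (φ : T →+* T')
    (M : Matrix α β T) (e : Fin r → α) (e' : Fin r → β) (h : IsUnit (M.submatrix e e').det)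
    (A : Set (α × β)) :
    (replaceBySkeleton M e e' A).map φ = replaceBySkeleton (M.map φ) e e' A := by
  ext i j
  simp only [replaceBySkeleton, ← skeleton_map φ M e e' h, Matrix.map_apply, Matrix.of_apply]
  split_ifs <;> rfl

theorem replaceBySkeleton_row {T : Type*} [CommRing T] {M : Matrix α β T} {e : Fin r → α}
    {e' : Fin r → β} (h : IsUnit (M.submatrix e e').det) (A : Set (α × β)) (i : Fin r) (j : β) :
    replaceBySkeleton M e e' A (e i) j = M (e i) j := by
  simp [replaceBySkeleton, skeleton_apply_row M e e' h]

theorem replaceBySkeleton_col {T : Type*} [CommRing T] {M : Matrix α β T} {e : Fin r → α}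
    {e' : Fin r → β} (h : IsUnit (M.submatrix e e').det) (A : Set (α × β)) (i : α) (j : Fin r) :
    replaceBySkeleton M e e' A i (e' j) = M i (e' j) := by
  simp [replaceBySkeleton, skeleton_apply_col M e e' h]

theorem skeleton_replaceBySkeleton {T : Type*} [CommRing T] {M : Matrix α β T} {e : Fin r → α}
    {e' : Fin r → β} (h : IsUnit (M.submatrix e e').det) (A : Set (α × β)) :
    skeleton (replaceBySkeleton M e e' A) e e' = skeleton M e e' :=
  skeleton_congr (replaceBySkeleton_row h A) (replaceBySkeleton_col h A)

theorem replaceBySkeleton_submatrix {T : Type*} [CommRing T] {M : Matrix α β T} {e : Fin r → α}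
    {e' : Fin r → β} (h : IsUnit (M.submatrix e e').det) (A : Set (α × β)) :
    (replaceBySkeleton M e e' A).submatrix e e' = M.submatrix e e' := by
  ext i j
  exact replaceBySkeleton_row h A i _

theorem replaceBySkeleton_replaceBySkeleton {T : Type*} [CommRing T] {M : Matrix α β T}
    {e : Fin r → α} {e' : Fin r → β} (h : IsUnit (M.submatrix e e').det) {A B : Set (α × β)}
    (hAB : A ⊆ B) :
    replaceBySkeleton (replaceBySkeleton M e e' B) e e' A = replaceBySkeleton M e e' B := by
  ext i j
  rw [replaceBySkeleton, skeleton_replaceBySkeleton h, Matrix.of_apply]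
  split_ifs with hA
  · simp [replaceBySkeleton, hAB hA]
  · rfl

variable (K α β) in
/-- The generic matrix over the field of rational functions. -/
noncomputable abbrev genericMatrixFrac : Matrix α β (FractionRing (MvPolynomial (α × β) K)) :=
  (genericMatrix K α β).map (algebraMap _ _)

theorem det_map_submatrix {S T : Type*} [CommRing S] [CommRing T] (φ : S →+* T)
    (M : Matrix α β S) {ι : Type*} [Fintype ι] [DecidableEq ι] (f : ι → α) (g : ι → β) :
    ((M.map φ).submatrix f g).det = φ (M.submatrix f g).det := by
  rw [RingHom.map_det]
  rfl

theorem isUnit_det_genericMatrixFrac {e : Fin r → α} {e' : Fin r → β}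
    (he : Function.Injective e) (he' : Function.Injective e') :
    IsUnit ((genericMatrixFrac K α β).submatrix e e').det := by
  rw [det_map_submatrix, isUnit_iff_ne_zero, Ne, FaithfulSMul.algebraMap_eq_zero_iff]
  exact det_genericMatrix_submatrix_ne_zero he he'

/-- The prime ideal of polynomials vanishing on the generic matrix whose entries in `A` have been
replaced by those of its skeleton. -/
noncomputable def skeletonIdeal (K : Type*) [Field K] (e : Fin r → α) (e' : Fin r → β)
    (A : Set (α × β)) : Ideal (MvPolynomial (α × β) K) :=
  RingHom.ker (evalAt (K := K) (replaceBySkeleton (genericMatrixFrac K α β) e e' A))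

instance (e : Fin r → α) (e' : Fin r → β) (A : Set (α × β)) : (skeletonIdeal K e e' A).IsPrime :=
  RingHom.ker_isPrime _

theorem mem_skeletonIdeal {e : Fin r → α} {e' : Fin r → β} {A : Set (α × β)}
    {f : MvPolynomial (α × β) K} : f ∈ skeletonIdeal K e e' A ↔
      evalAt (replaceBySkeleton (genericMatrixFrac K α β) e e' A) f = 0 :=
  RingHom.mem_ker

/-- The generic matrix over the localization inverting the `(e, e')`-minor. -/
noncomputable abbrev genericMatrixAway (K : Type*) [Field K] (e : Fin r → α) (e' : Fin r → β) :
    Matrix α β (Localization.Away ((genericMatrix K α β).submatrix e e').det) :=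
  (genericMatrix K α β).map (algebraMap _ _)

theorem exists_algHom_genericMatrixAway {T : Type*} [CommRing T] [Algebra K T] {e : Fin r → α}
    {e' : Fin r → β} (M : Matrix α β T) (h : IsUnit (M.submatrix e e').det) :
    ∃ φ : Localization.Away ((genericMatrix K α β).submatrix e e').det →ₐ[K] T,
      (genericMatrixAway K e e').map φ = M ∧
        ∀ a : MvPolynomial (α × β) K, φ (algebraMap _ _ a) = evalAt M a := by
  have hu : ∀ y : Submonoid.powers ((genericMatrix K α β).submatrix e e').det,
      IsUnit (evalAt (K := K) M y) := by
    rintro ⟨_, n, rfl⟩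
    simp only [map_pow]
    exact IsUnit.pow _ (by rw [evalAt_det]; exact h)
  refine ⟨IsLocalization.liftAlgHom hu, ?_, fun a => ?_⟩
  · ext i j
    simp
  · simp

/-- Polynomials in `skeletonIdeal K e e' A` vanish at every matrix, over any algebra, with
invertible `(e, e')`-minor after its entries in `A` are replaced. -/
theorem evalAt_replaceBySkeleton_eq_zero {e : Fin r → α} {e' : Fin r → β}
    (he : Function.Injective e) (he' : Function.Injective e') {A : Set (α × β)}
    {f : MvPolynomial (α × β) K} (hf : f ∈ skeletonIdeal K e e' A)
    {T : Type*} [CommRing T] [Algebra K T] (M : Matrix α β T)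
    (h : IsUnit (M.submatrix e e').det) : evalAt (replaceBySkeleton M e e' A) f = 0 := by
  have hN : IsUnit ((genericMatrixAway K e e').submatrix e e').det := by
    rw [det_map_submatrix]
    exact IsLocalization.Away.algebraMap_isUnit _
  obtain ⟨φ, hφ, -⟩ := exists_algHom_genericMatrixAway (K := K) M h
  obtain ⟨ψ, hψ, hψ'⟩ := exists_algHom_genericMatrixAway (K := K) (genericMatrixFrac K α β)
    (isUnit_det_genericMatrixFrac he he')
  have hinj : ∀ x, ψ x = 0 → x = 0 := by
    intro x hx
    obtain ⟨a, s, rfl⟩ := IsLocalization.exists_mk'_eq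
      (Submonoid.powers ((genericMatrix K α β).submatrix e e').det) x
    have h1 : ψ (algebraMap _ _ a) = 0 := by
      rw [← IsLocalization.mk'_spec (Localization.Away _) a s, map_mul, hx, zero_mul]
    rw [hψ', evalAt_map_algebraMap, FaithfulSMul.algebraMap_eq_zero_iff] at h1
    rw [h1, IsLocalization.mk'_zero]
  have h0 : evalAt (replaceBySkeleton (genericMatrixAway K e e') e e' A) f = 0 := by
    apply hinj
    rw [← evalAt_comp]
    have := replaceBySkeleton_map ψ.toRingHom _ e e' hN A
    simp only [AlgHom.toRingHom_eq_coe, RingHom.coe_coe] at this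
    rw [this, hψ]
    exact mem_skeletonIdeal.1 hf
  have := replaceBySkeleton_map φ.toRingHom _ e e' hN A
  simp only [AlgHom.toRingHom_eq_coe, RingHom.coe_coe] at this
  rw [← hφ, ← this, evalAt_comp, h0, map_zero]

theorem sub_skeleton_eq_zero_of_minorsIdeal {T : Type*} [CommRing T] {M : Matrix α β T}
    {e : Fin r → α} {e' : Fin r → β} (h : IsUnit (M.submatrix e e').det)
    (hM : minorsIdeal (r + 1) M = ⊥) : M - skeleton M e e' = 0 := by
  rw [minorsIdeal_eq_of_isUnit M e e' h] at hM
  ext i j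
  have := det_submatrix_mem_minorsIdeal (M - skeleton M e e')
    (Function.injective_of_subsingleton (fun _ : Fin 1 => i))
    (Function.injective_of_subsingleton (fun _ : Fin 1 => j))
  rw [hM, Ideal.mem_bot] at this
  simpa using this

theorem skeletonIdeal_le {e : Fin r → α} {e' : Fin r → β} (he : Function.Injective e)
    (he' : Function.Injective e') (A : Set (α × β)) (p : Ideal (MvPolynomial (α × β) K))
    [p.IsPrime] (hp : minorsIdeal (r + 1) (genericMatrix K α β) ≤ p)
    (hd : ((genericMatrix K α β).submatrix e e').det ∉ p) : skeletonIdeal K e e' A ≤ p := by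
  intro f hf
  let M := (genericMatrix K α β).map (algebraMap _ p.ResidueField)
  have hM : IsUnit (M.submatrix e e').det := by
    rw [det_map_submatrix, isUnit_iff_ne_zero, Ne, Ideal.algebraMap_residueField_eq_zero]
    exact hd
  have hM0 : M - skeleton M e e' = 0 := by
    refine sub_skeleton_eq_zero_of_minorsIdeal hM ?_
    rw [← minorsIdeal_map, Ideal.map_eq_bot_iff_le_ker, Ideal.ker_algebraMap_residueField]
    exact hp
  have := evalAt_replaceBySkeleton_eq_zero he he' hf M hM
  rw [replaceBySkeleton_eq_self hM0, evalAt_map_algebraMap,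
    Ideal.algebraMap_residueField_eq_zero] at this
  exact this

theorem skeletonIdeal_mono {e : Fin r → α} {e' : Fin r → β} (he : Function.Injective e)
    (he' : Function.Injective e') {A B : Set (α × β)} (hAB : A ⊆ B) :
    skeletonIdeal K e e' A ≤ skeletonIdeal K e e' B := by
  intro f hf
  have hu := isUnit_det_genericMatrixFrac (K := K) he he'
  have := evalAt_replaceBySkeleton_eq_zero he he' hf
    (replaceBySkeleton (genericMatrixFrac K α β) e e' B)
    (by rw [replaceBySkeleton_submatrix hu]; exact hu)
  rw [replaceBySkeleton_replaceBySkeleton hu hAB] at this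
  exact mem_skeletonIdeal.2 this

/-- The minor obtained from the `(e, e')`-minor by adjoining row `i` and column `j` lies in
`skeletonIdeal K e e' A` exactly when `(i, j) ∈ A`. -/
theorem bordered_mem_skeletonIdeal_iff {e : Fin r → α} {e' : Fin r → β}
    (he : Function.Injective e) (he' : Function.Injective e') {A : Set (α × β)} {i : α} {j : β}
    (hi : i ∉ Set.range e) (hj : j ∉ Set.range e') :
    ((genericMatrix K α β).submatrix (Sum.elim e fun _ : Unit => i)
      (Sum.elim e' fun _ : Unit => j)).det ∈ skeletonIdeal K e e' A ↔ (i, j) ∈ A := by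
  have hu := isUnit_det_genericMatrixFrac (K := K) he he'
  have hne : (genericMatrixFrac K α β - skeleton (genericMatrixFrac K α β) e e') i j ≠ 0 := by
    intro h0
    have h1 := det_submatrix_sumElim _ e e' hu (fun _ : Unit => i) (fun _ : Unit => j)
    rw [Matrix.det_unique (Matrix.submatrix (_ - _) _ _), Matrix.submatrix_apply, h0, mul_zero,
      det_map_submatrix, FaithfulSMul.algebraMap_eq_zero_iff] at h1
    refine det_genericMatrix_submatrix_ne_zero ?_ ?_ h1
    · exact he.sumElim (Function.injective_of_subsingleton _) fun a _ h => hi ⟨a, h⟩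
    · exact he'.sumElim (Function.injective_of_subsingleton _) fun a _ h => hj ⟨a, h⟩
  rw [mem_skeletonIdeal, evalAt_det, det_submatrix_sumElim _ e e'
    (by rw [replaceBySkeleton_submatrix hu]; exact hu), skeleton_replaceBySkeleton hu,
    replaceBySkeleton_submatrix hu, hu.mul_right_eq_zero, Matrix.det_unique,
    Matrix.submatrix_apply]
  by_cases hA : (i, j) ∈ A
  · simp [replaceBySkeleton, hA]
  · simpa [replaceBySkeleton, hA] using hne

theorem card_le_height_skeletonIdeal {e : Fin r → α} {e' : Fin r → β}
    (he : Function.Injective e) (he' : Function.Injective e') (A : Finset (α × β))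
    (hA : ∀ x ∈ A, x.1 ∉ Set.range e ∧ x.2 ∉ Set.range e') :
    (A.card : ℕ∞) ≤ (skeletonIdeal K e e' (A : Set (α × β))).height := by
  classical
  induction A using Finset.induction_on with
  | empty => simp
  | insert x A hx ih =>
    have h1 := ih fun y hy => hA y (Finset.mem_insert_of_mem hy)
    obtain ⟨hi, hj⟩ := hA x (Finset.mem_insert_self _ _)
    have hlt : skeletonIdeal K e e' (A : Set (α × β)) <
        skeletonIdeal K e e' ((insert x A : Finset (α × β)) : Set (α × β)) := by
      refine lt_of_le_of_ne (skeletonIdeal_mono he he' (by simp)) fun heq => ?_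
      have h2 := (bordered_mem_skeletonIdeal_iff (K := K) he he'
        (A := ((insert x A : Finset (α × β)) : Set (α × β))) hi hj).2 (by simp)
      rw [← heq, bordered_mem_skeletonIdeal_iff he he' hi hj] at h2
      exact hx h2
    rw [Finset.card_insert_of_notMem hx, Nat.cast_add, Nat.cast_one]
    exact (add_le_add_left h1 1).trans (Ideal.height_add_one_le_of_lt_of_isPrime hlt)

theorem le_height_of_det_notMem [Fintype α] [Fintype β] {e : Fin r → α} {e' : Fin r → β}
    (he : Function.Injective e) (he' : Function.Injective e')
    (p : Ideal (MvPolynomial (α × β) K)) [p.IsPrime]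
    (hp : minorsIdeal (r + 1) (genericMatrix K α β) ≤ p)
    (hd : ((genericMatrix K α β).submatrix e e').det ∉ p) :
    (((Fintype.card α - r) * (Fintype.card β - r) : ℕ) : ℕ∞) ≤ p.height := by
  classical
  have h1 := card_le_height_skeletonIdeal (K := K) he he'
    ((Finset.univ.image e)ᶜ ×ˢ (Finset.univ.image e')ᶜ) (by simp)
  refine le_trans (le_of_eq ?_) (h1.trans (Ideal.height_mono (skeletonIdeal_le he he' _ p hp hd)))
  rw [Finset.card_product, Finset.card_compl, Finset.card_compl,
    Finset.card_image_of_injective _ he, Finset.card_image_of_injective _ he']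
  simp

end Generic

section GenericPoint

open PowerSeries in
theorem coeff_mul_of_X_pow_dvd {L : Type*} [CommRing L] {k : ℕ} {g : L⟦X⟧}
    (hg : (PowerSeries.X : L⟦X⟧) ^ k ∣ g) (a : L⟦X⟧) :
    PowerSeries.coeff k (a * g) = PowerSeries.constantCoeff a * PowerSeries.coeff k g := by
  obtain ⟨h, rfl⟩ := hg
  have h1 := PowerSeries.coeff_X_pow_mul h k 0
  have h2 := PowerSeries.coeff_X_pow_mul (a * h) k 0
  rw [zero_add] at h1 h2
  rw [mul_left_comm, h2, h1]
  simp

variable {K : Type*} [Field K] {α β : Type*} {r : ℕ}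

/-- The generic matrix of rank `r`. -/
noncomputable abbrev rankMatrix (K : Type*) [Field K] (e : Fin r → α) (e' : Fin r → β) :
    Matrix α β (FractionRing (MvPolynomial (α × β) K)) :=
  skeleton (genericMatrixFrac K α β) e e'

theorem mem_skeletonIdeal_univ {e : Fin r → α} {e' : Fin r → β}
    {f : MvPolynomial (α × β) K} : f ∈ skeletonIdeal K e e' Set.univ ↔
      evalAt (rankMatrix K e e') f = 0 := by
  rw [mem_skeletonIdeal, replaceBySkeleton_univ]

theorem isUnit_det_rankMatrix {e : Fin r → α} {e' : Fin r → β} (he : Function.Injective e)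
    (he' : Function.Injective e') : IsUnit ((rankMatrix K e e').submatrix e e').det := by
  have hu := isUnit_det_genericMatrixFrac (K := K) he he'
  rw [rankMatrix, ← replaceBySkeleton_univ, replaceBySkeleton_submatrix hu]
  exact hu

theorem skeleton_rankMatrix {e : Fin r → α} {e' : Fin r → β} (he : Function.Injective e)
    (he' : Function.Injective e') : skeleton (rankMatrix K e e') e e' = rankMatrix K e e' := by
  have hu := isUnit_det_genericMatrixFrac (K := K) he he'
  have h := skeleton_replaceBySkeleton hu Set.univ
  rwa [replaceBySkeleton_univ] at h

theorem det_notMem_skeletonIdeal {e : Fin r → α} {e' : Fin r → β} (he : Function.Injective e)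
    (he' : Function.Injective e') :
    ((genericMatrix K α β).submatrix e e').det ∉ skeletonIdeal K e e' Set.univ := by
  rw [mem_skeletonIdeal_univ, evalAt_det]
  exact (isUnit_det_rankMatrix he he').ne_zero

theorem minorsIdeal_le_skeletonIdeal {e : Fin r → α} {e' : Fin r → β}
    (he : Function.Injective e) (he' : Function.Injective e') {k : ℕ} (hk : 1 ≤ k) :
    minorsIdeal (r + k) (genericMatrix K α β) ≤ skeletonIdeal K e e' Set.univ := by
  intro f hf
  rw [mem_skeletonIdeal_univ]
  have h1 := Ideal.mem_map_of_mem (evalAt (K := K) (rankMatrix K e e')).toRingHom hf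
  have h2 : (genericMatrix K α β).map (evalAt (K := K) (rankMatrix K e e')).toRingHom =
    rankMatrix K e e' := genericMatrix_map_evalAt _
  rw [minorsIdeal_map, h2, minorsIdeal_eq_of_isUnit _ e e' (isUnit_det_rankMatrix he he'),
    skeleton_rankMatrix he he', sub_self] at h1
  have h3 : minorsIdeal k (0 : Matrix α β (FractionRing (MvPolynomial (α × β) K))) ≤ ⊥ := by
    refine Ideal.span_le.2 ?_
    rintro _ ⟨f, g, -, -, rfl⟩
    have : Nonempty (Fin k) := ⟨⟨0, hk⟩⟩
    simp [Matrix.submatrix_zero]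
  exact h3 h1

theorem isUnit_det_localization {p : Ideal (MvPolynomial (α × β) K)} [p.IsPrime] {e : Fin r → α}
    {e' : Fin r → β} (hd : ((genericMatrix K α β).submatrix e e').det ∉ p) :
    IsUnit (((genericMatrix K α β).map
      (algebraMap _ (Localization.AtPrime p))).submatrix e e').det := by
  rw [det_map_submatrix]
  exact IsLocalization.map_units (Localization.AtPrime p)
    (⟨_, hd⟩ : p.primeCompl)

theorem ringKrullDim_localization_skeletonIdeal_le [Fintype α] [LinearOrder α] [Fintype β]
    [LinearOrder β] {e : Fin r → α} {e' : Fin r → β}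
    (he : Function.Injective e) (he' : Function.Injective e') :
    ringKrullDim (Localization.AtPrime (skeletonIdeal K e e' Set.univ)) ≤
      (((Fintype.card α - r) * (Fintype.card β - r) : ℕ) : WithBot ℕ∞) := by
  let p := skeletonIdeal K e e' Set.univ
  let N := (genericMatrix K α β).map (algebraMap _ (Localization.AtPrime p))
  have hN : IsUnit (N.submatrix e e').det :=
    isUnit_det_localization (det_notMem_skeletonIdeal he he')
  let J := minorsIdeal (r + 1) N
  have hJ : J = IsLocalRing.maximalIdeal (Localization.AtPrime p) := by
    rw [← Localization.AtPrime.map_eq_maximalIdeal]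
    apply le_antisymm
    · refine (minorsIdeal_map _ _ _).symm.le.trans ?_
      exact Ideal.map_mono (minorsIdeal_le_skeletonIdeal he he' le_rfl)
    · refine Ideal.map_le_iff_le_comap.2 fun f hf => ?_
      let M := (genericMatrix K α β).map (algebraMap _ (Localization.AtPrime p ⧸ J))
      have hMN : M = N.map (Ideal.Quotient.mk J) := rfl
      have hM : IsUnit (M.submatrix e e').det := by
        rw [hMN, det_map_submatrix]
        exact hN.map _
      have hM0 : M - skeleton M e e' = 0 := by
        refine sub_skeleton_eq_zero_of_minorsIdeal hM ?_
        rw [hMN, ← minorsIdeal_map]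
        exact Ideal.map_quotient_self J
      have h0 := evalAt_replaceBySkeleton_eq_zero he he' hf M hM
      rw [replaceBySkeleton_eq_self hM0, evalAt_map_algebraMap] at h0
      exact (Ideal.Quotient.eq_zero_iff_mem (I := J)).1 h0
  obtain ⟨s, hs, hspan⟩ := exists_finset_span_eq_minorsIdeal N he he' hN 1
  rw [← IsLocalRing.maximalIdeal_height_eq_ringKrullDim]
  have h1 : (IsLocalRing.maximalIdeal (Localization.AtPrime p)).height ≤ s.card := by
    apply Ideal.height_le_card_of_mem_minimalPrimes_span_finset
    have : Ideal.span (s : Set (Localization.AtPrime p)) =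
      IsLocalRing.maximalIdeal (Localization.AtPrime p) := hspan.trans hJ
    rw [this, Ideal.minimalPrimes_eq_subsingleton_self]
    rfl
  rw [Nat.choose_one_right, Nat.choose_one_right] at hs
  exact WithBot.coe_le_coe.2 (h1.trans (Nat.cast_le.2 hs))

section PartialIdentity

variable [Fintype α] [LinearOrder α] [Fintype β] [LinearOrder β]

open Classical in
/-- The partial permutation matrix matching two `k`-element sets in increasing order. -/
noncomputable def partialIdentity (L : Type*) [CommRing L] {k : ℕ} {e : Fin r → α} {e' : Fin r → β}
    (x : avoidingSubsets e k × avoidingSubsets e' k) : Matrix α β L :=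
  Matrix.of fun i j => if ∃ u, avoidingEmb x.1 u = i ∧ avoidingEmb x.2 u = j then 1 else 0

theorem eq_of_forall_avoidingEmb_mem {k : ℕ} {e : Fin r → α} {s t : avoidingSubsets e k}
    (h : ∀ u, avoidingEmb s u ∈ t.1) : s = t := by
  apply Subtype.ext
  refine Finset.eq_of_subset_of_card_le (fun i hi => ?_) ?_
  · rw [← Finset.mem_coe, ← range_avoidingEmb] at hi
    obtain ⟨u, rfl⟩ := hi
    exact h u
  · rw [(Finset.mem_powersetCard.1 s.2).2, (Finset.mem_powersetCard.1 t.2).2]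

open Classical in
theorem det_partialIdentity (L : Type*) [CommRing L] {k : ℕ} {e : Fin r → α}
    {e' : Fin r → β} (x y : avoidingSubsets e k × avoidingSubsets e' k) :
    ((partialIdentity L x).submatrix (avoidingEmb y.1) (avoidingEmb y.2)).det =
      if x = y then 1 else 0 := by
  split_ifs with hxy
  · subst hxy
    convert Matrix.det_one (R := L) (n := Fin k)
    ext i j
    simp only [partialIdentity, Matrix.submatrix_apply, Matrix.of_apply, Matrix.one_apply]
    congr 1
    simp
  · by_cases h1 : y.1 = x.1
    · have h2 : y.2 ≠ x.2 := fun h2 => hxy (Prod.ext h1 h2).symm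
      have h3 := mt eq_of_forall_avoidingEmb_mem h2
      push Not at h3
      obtain ⟨u, hu⟩ := h3
      refine Matrix.det_eq_zero_of_column_eq_zero u fun i => ?_
      simp only [partialIdentity, Matrix.submatrix_apply, Matrix.of_apply, ite_eq_right_iff]
      rintro ⟨v, -, hv⟩
      exact absurd (hv ▸ avoidingEmb_mem x.2 v) hu
    · have h3 := mt eq_of_forall_avoidingEmb_mem h1
      push Not at h3
      obtain ⟨u, hu⟩ := h3
      refine Matrix.det_eq_zero_of_row_eq_zero u fun i => ?_
      simp only [partialIdentity, Matrix.submatrix_apply, Matrix.of_apply, ite_eq_right_iff]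
      rintro ⟨v, hv, -⟩
      exact absurd (hv ▸ avoidingEmb_mem x.1 v) hu

theorem partialIdentity_row (L : Type*) [CommRing L] {k : ℕ} {e : Fin r → α} {e' : Fin r → β}
    (x : avoidingSubsets e k × avoidingSubsets e' k) (i : Fin r) (j : β) :
    partialIdentity L x (e i) j = 0 := by
  simp [partialIdentity, avoidingEmb_ne]

theorem partialIdentity_col (L : Type*) [CommRing L] {k : ℕ} {e : Fin r → α} {e' : Fin r → β}
    (x : avoidingSubsets e k × avoidingSubsets e' k) (i : α) (j : Fin r) :
    partialIdentity L x i (e' j) = 0 := by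
  simp [partialIdentity, avoidingEmb_ne]

open PowerSeries

/-- The first-order deformation of the generic rank `r` matrix in the direction of a partial
permutation matrix. -/
noncomputable def deformation (K : Type*) [Field K] {k : ℕ} {e : Fin r → α} {e' : Fin r → β}
    (x : avoidingSubsets e k × avoidingSubsets e' k) :
    Matrix α β (FractionRing (MvPolynomial (α × β) K))⟦X⟧ :=
  (rankMatrix K e e').map PowerSeries.C +
    (PowerSeries.X : (FractionRing (MvPolynomial (α × β) K))⟦X⟧) •
      (partialIdentity (FractionRing (MvPolynomial (α × β) K)) x).map PowerSeries.C

variable {k : ℕ} {e : Fin r → α} {e' : Fin r → β}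

theorem deformation_row (x : avoidingSubsets e k × avoidingSubsets e' k) (i : Fin r) (j : β) :
    deformation K x (e i) j = (rankMatrix K e e').map PowerSeries.C (e i) j := by
  simp [deformation, partialIdentity_row]

theorem deformation_col (x : avoidingSubsets e k × avoidingSubsets e' k) (i : α) (j : Fin r) :
    deformation K x i (e' j) = (rankMatrix K e e').map PowerSeries.C i (e' j) := by
  simp [deformation, partialIdentity_col]

theorem isUnit_det_deformation (he : Function.Injective e) (he' : Function.Injective e')
    (x : avoidingSubsets e k × avoidingSubsets e' k) :
    IsUnit ((deformation K x).submatrix e e').det := by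
  have : (deformation K x).submatrix e e' =
      ((rankMatrix K e e').map PowerSeries.C).submatrix e e' := by
    ext1 i j
    exact deformation_row x i _
  rw [this, det_map_submatrix]
  exact (isUnit_det_rankMatrix he he').map _

theorem deformation_sub_skeleton (he : Function.Injective e) (he' : Function.Injective e')
    (x : avoidingSubsets e k × avoidingSubsets e' k) :
    deformation K x - skeleton (deformation K x) e e' =
      (PowerSeries.X : (FractionRing (MvPolynomial (α × β) K))⟦X⟧) •
      (partialIdentity (FractionRing (MvPolynomial (α × β) K)) x).map PowerSeries.C := by
  rw [skeleton_congr (deformation_row x) (deformation_col x),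
    ← skeleton_map _ _ e e' (isUnit_det_rankMatrix he he'), skeleton_rankMatrix he he',
    deformation, add_sub_cancel_left]

theorem det_deformation_sub_skeleton (he : Function.Injective e) (he' : Function.Injective e')
    (x : avoidingSubsets e k × avoidingSubsets e' k) (f : Fin k → α) (g : Fin k → β) :
    ((deformation K x - skeleton (deformation K x) e e').submatrix f g).det =
      (PowerSeries.X : (FractionRing (MvPolynomial (α × β) K))⟦X⟧) ^ k * PowerSeries.C
        ((partialIdentity (FractionRing (MvPolynomial (α × β) K)) x).submatrix f g).det := by
  rw [deformation_sub_skeleton he he', Matrix.submatrix_smul, Pi.smul_apply, Pi.smul_apply,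
    Matrix.det_smul, Fintype.card_fin, det_map_submatrix]

theorem constantCoeff_evalAt_deformation (x : avoidingSubsets e k × avoidingSubsets e' k)
    (f : MvPolynomial (α × β) K) :
    PowerSeries.constantCoeff (evalAt (deformation K x) f) = evalAt (rankMatrix K e e') f := by
  let c : (FractionRing (MvPolynomial (α × β) K))⟦X⟧ →ₐ[K] FractionRing (MvPolynomial (α × β) K) :=
    { PowerSeries.constantCoeff with
      commutes' := fun a => by simp [PowerSeries.algebraMap_apply] }
  have h1 : (deformation K x).map c = rankMatrix K e e' := by
    ext i j
    simp [c, deformation]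
  rw [← h1, evalAt_comp]
  rfl

theorem X_pow_dvd_of_mem_minorsIdeal (he : Function.Injective e) (he' : Function.Injective e')
    (x : avoidingSubsets e k × avoidingSubsets e' k)
    {g : (FractionRing (MvPolynomial (α × β) K))⟦X⟧}
    (hg : g ∈ minorsIdeal (r + k) (deformation K x)) : PowerSeries.X ^ k ∣ g := by
  rw [minorsIdeal_eq_of_isUnit _ e e' (isUnit_det_deformation he he' x)] at hg
  rw [← Ideal.mem_span_singleton]
  refine (Ideal.span_le.2 ?_ : minorsIdeal k _ ≤ _) hg
  rintro _ ⟨f, g, -, -, rfl⟩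
  rw [det_deformation_sub_skeleton he he']
  exact Ideal.mem_span_singleton.2 (dvd_mul_right _ _)

theorem exists_ringHom_deformation (x : avoidingSubsets e k × avoidingSubsets e' k) :
    ∃ Ψ : Localization.AtPrime (skeletonIdeal K e e' Set.univ) →+*
        (FractionRing (MvPolynomial (α × β) K))⟦X⟧,
      ∀ f : MvPolynomial (α × β) K, Ψ (algebraMap _ _ f) = evalAt (deformation K x) f := by
  have hu : ∀ y : (skeletonIdeal K e e' Set.univ).primeCompl,
      IsUnit ((evalAt (K := K) (deformation K x)).toRingHom y) := by
    intro y
    rw [PowerSeries.isUnit_iff_constantCoeff]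
    have := constantCoeff_evalAt_deformation x y.1
    rw [isUnit_iff_ne_zero]
    exact fun h => y.2 (mem_skeletonIdeal_univ.2 (this.symm.trans h))
  exact ⟨IsLocalization.lift hu, fun f => IsLocalization.lift_eq hu f⟩

theorem le_card_of_span_eq (he : Function.Injective e) (he' : Function.Injective e')
    (s : Finset (Localization.AtPrime (skeletonIdeal K e e' Set.univ)))
    (hs : Ideal.span (s : Set _) = minorsIdeal (r + k) ((genericMatrix K α β).map
      (algebraMap _ (Localization.AtPrime (skeletonIdeal K e e' Set.univ))))) :
    (Fintype.card α - r).choose k * (Fintype.card β - r).choose k ≤ s.card := by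
  classical
  let N := (genericMatrix K α β).map
    (algebraMap _ (Localization.AtPrime (skeletonIdeal K e e' Set.univ)))
  have hN : IsUnit (N.submatrix e e').det :=
    isUnit_det_localization (det_notMem_skeletonIdeal he he')
  choose Ψ hΨ using exists_ringHom_deformation (K := K) (k := k) (e := e) (e' := e')
  have hNΨ : ∀ x, N.map (Ψ x) = deformation K x := by
    intro x
    ext1 i j
    simp only [N, Matrix.map_apply, hΨ]
    simp
  have hconst : ∀ x y a, PowerSeries.constantCoeff (Ψ x a) = PowerSeries.constantCoeff (Ψ y a) := by
    intro x y a
    have : (PowerSeries.constantCoeff.comp (Ψ x)) = (PowerSeries.constantCoeff.comp (Ψ y)) := by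
      apply IsLocalization.ringHom_ext (skeletonIdeal K e e' Set.univ).primeCompl
      refine RingHom.ext fun f => ?_
      simp only [RingHom.comp_apply, hΨ, constantCoeff_evalAt_deformation]
    exact RingHom.congr_fun this a
  let D : Localization.AtPrime (skeletonIdeal K e e' Set.univ) →
      (avoidingSubsets e k × avoidingSubsets e' k → FractionRing (MvPolynomial (α × β) K)) :=
    fun g x => PowerSeries.coeff k (Ψ x g)
  have hdvd : ∀ x, ∀ g ∈ Ideal.span (s : Set (Localization.AtPrime
      (skeletonIdeal K e e' Set.univ))), PowerSeries.X ^ k ∣ Ψ x g := by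
    intro x g hg
    rw [hs] at hg
    have := Ideal.mem_map_of_mem (Ψ x) hg
    rw [minorsIdeal_map] at this
    rw [hNΨ] at this
    exact X_pow_dvd_of_mem_minorsIdeal he he' x this
  have hspan : ∀ g ∈ Ideal.span (s : Set (Localization.AtPrime
      (skeletonIdeal K e e' Set.univ))),
      D g ∈ Submodule.span (FractionRing (MvPolynomial (α × β) K)) (Set.range fun y : s => D y) := by
    intro g hg
    induction hg using Submodule.span_induction with
    | mem g hg => exact Submodule.subset_span ⟨⟨g, hg⟩, rfl⟩
    | zero =>
      convert Submodule.zero_mem _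
      ext x
      simp [D]
    | add a b _ _ ha hb =>
      convert Submodule.add_mem _ ha hb
      ext x
      simp [D]
    | smul a b hb ih =>
      rcases isEmpty_or_nonempty (avoidingSubsets e k × avoidingSubsets e' k) with hE | ⟨⟨y⟩⟩
      · rw [Subsingleton.elim (D (a • b)) 0]
        exact Submodule.zero_mem _
      · convert Submodule.smul_mem _ (PowerSeries.constantCoeff (Ψ y a)) ih
        ext x
        simp only [D, smul_eq_mul, map_mul, Pi.smul_apply]
        rw [coeff_mul_of_X_pow_dvd (hdvd x b hb), hconst x y]
  have htop : Submodule.span (FractionRing (MvPolynomial (α × β) K))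
      (Set.range fun y : s => D y) = ⊤ := by
    rw [eq_top_iff, ← (Pi.basisFun (FractionRing (MvPolynomial (α × β) K))
      (avoidingSubsets e k × avoidingSubsets e' k)).span_eq, Submodule.span_le]
    rintro _ ⟨y, rfl⟩
    have hmem : ((N - skeleton N e e').submatrix (avoidingEmb y.1) (avoidingEmb y.2)).det ∈
        Ideal.span (s : Set (Localization.AtPrime (skeletonIdeal K e e' Set.univ))) := by
      rw [hs, minorsIdeal_eq_of_isUnit N e e' hN]
      exact det_submatrix_mem_minorsIdeal _ (avoidingEmb y.1).injective (avoidingEmb y.2).injective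
    refine (congrArg (· ∈ Submodule.span (FractionRing (MvPolynomial (α × β) K))
      (Set.range fun y : s => D y)) (funext fun x => ?_)).mpr (hspan _ hmem)
    have hmap : (N - skeleton N e e').map (Ψ x) =
        deformation K x - skeleton (deformation K x) e e' := by
      rw [← hNΨ, ← skeleton_map _ _ e e' hN]
      ext1 i j
      simp
    simp only [D]
    rw [← det_map_submatrix, hmap, det_deformation_sub_skeleton he he', det_partialIdentity]
    have := PowerSeries.coeff_X_pow_mul (PowerSeries.C (if x = y then (1 :
      FractionRing (MvPolynomial (α × β) K)) else 0)) k 0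
    rw [zero_add] at this
    rw [this]
    simp [Pi.single_apply]
  have hfr := finrank_range_le_card (R := FractionRing (MvPolynomial (α × β) K))
    (fun y : s => D y)
  rw [Set.finrank, htop, finrank_top, Module.finrank_fintype_fun_eq_card, Fintype.card_prod,
    Fintype.card_coe, Fintype.card_coe, Fintype.card_coe, card_avoidingSubsets he,
    card_avoidingSubsets he'] at hfr
  exact hfr

end PartialIdentity

end GenericPoint

section Main

variable {K : Type*} [Field K] {α β : Type*} [Fintype α] [LinearOrder α] [Fintype β]
  [LinearOrder β]

/-- At a prime containing the `t`-minors of the generic matrix, whose residual rank is `r = t - k`,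
the number of generators is bounded above and the dimension is bounded below. -/
theorem exists_mu_le_and_le_ringKrullDim {t : ℕ} (p : Ideal (MvPolynomial (α × β) K)) [p.IsPrime]
    (hp : minorsIdeal t (genericMatrix K α β) ≤ p) :
    ∃ r k : ℕ, r + k = t ∧ 1 ≤ k ∧
      mu ((minorsIdeal t (genericMatrix K α β)).map (algebraMap _ (Localization.AtPrime p))) ≤
        (Fintype.card α - r).choose k * (Fintype.card β - r).choose k ∧
      (((Fintype.card α - r) * (Fintype.card β - r) : ℕ) : WithBot ℕ∞) ≤
        ringKrullDim (Localization.AtPrime p) := by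
  classical
  have hex : ∃ j, minorsIdeal j (genericMatrix K α β) ≤ p := ⟨t, hp⟩
  have h0 : ¬ minorsIdeal 0 (genericMatrix K α β) ≤ p := by
    intro h
    have h1 := h (det_submatrix_mem_minorsIdeal _ (f := Fin.elim0) (g := Fin.elim0)
      (fun x => x.elim0) (fun x => x.elim0))
    rw [Matrix.det_fin_zero] at h1
    exact Ideal.IsPrime.ne_top ‹_› ((Ideal.eq_top_iff_one p).2 h1)
  obtain ⟨r, hr⟩ : ∃ r, Nat.find hex = r + 1 :=
    Nat.exists_eq_succ_of_ne_zero fun h => h0 (h ▸ Nat.find_spec hex)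
  have hr1 : minorsIdeal (r + 1) (genericMatrix K α β) ≤ p := hr ▸ Nat.find_spec hex
  have hr0 : ¬ minorsIdeal r (genericMatrix K α β) ≤ p := Nat.find_min hex (by omega)
  have hrt : r + 1 ≤ t := hr ▸ Nat.find_min' hex hp
  rw [minorsIdeal, Ideal.span_le, Set.not_subset] at hr0
  obtain ⟨_, ⟨e, e', he, he', rfl⟩, hd⟩ := hr0
  obtain ⟨k, rfl⟩ := Nat.exists_eq_add_of_le (Nat.le_of_succ_le hrt)
  refine ⟨r, k, rfl, by omega, ?_, ?_⟩
  · obtain ⟨s, hs, hspan⟩ :=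
      exists_finset_span_eq_minorsIdeal _ he he' (isUnit_det_localization hd) k
    rw [minorsIdeal_map]
    exact (mu_le_card _ s hspan).trans hs
  · rw [IsLocalization.AtPrime.ringKrullDim_eq_height p]
    exact WithBot.coe_le_coe.2 (le_height_of_det_notMem he he' p hr1 hd)

/-- The bounds of `exists_mu_le_and_le_ringKrullDim` are attained at the generic point of the
locus of matrices of rank at most `r`. -/
theorem exists_prime_le_mu_and_ringKrullDim_le {r k : ℕ} (hk : 1 ≤ k)
    (hα : r ≤ Fintype.card α) (hβ : r ≤ Fintype.card β) :
    ∃ (p : Ideal (MvPolynomial (α × β) K)) (_ : p.IsPrime),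
      minorsIdeal (r + k) (genericMatrix K α β) ≤ p ∧
      (Fintype.card α - r).choose k * (Fintype.card β - r).choose k ≤
        mu ((minorsIdeal (r + k) (genericMatrix K α β)).map
          (algebraMap _ (Localization.AtPrime p))) ∧
      ringKrullDim (Localization.AtPrime p) ≤
        (((Fintype.card α - r) * (Fintype.card β - r) : ℕ) : WithBot ℕ∞) := by
  obtain ⟨e⟩ : Nonempty (Fin r ↪ α) := Function.Embedding.nonempty_of_card_le (by simpa using hα)
  obtain ⟨e'⟩ : Nonempty (Fin r ↪ β) := Function.Embedding.nonempty_of_card_le (by simpa using hβ)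
  have he := e.injective
  have he' := e'.injective
  refine ⟨skeletonIdeal K e e' Set.univ, inferInstance, minorsIdeal_le_skeletonIdeal he he' hk, ?_,
    ringKrullDim_localization_skeletonIdeal_le he he'⟩
  rw [minorsIdeal_map]
  obtain ⟨s, -, hspan⟩ := exists_finset_span_eq_minorsIdeal _ he he'
    (isUnit_det_localization (det_notMem_skeletonIdeal (K := K) he he')) k
  obtain ⟨s', hs', hspan'⟩ := exists_finset_card_eq_mu _ s hspan
  rw [← hs']
  exact le_card_of_span_eq he he' s' hspan'

/-- `G_s` holds for the `t`-minors as soon as the numerical inequality holds at each rank stratum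
of codimension less than `s`. -/
theorem satisfiesG_minorsIdeal {t a b s : ℕ} (hα : Fintype.card α = t + a)
    (hβ : Fintype.card β = t + b) (hs : 1 ≤ s)
    (h : ∀ k, 1 ≤ k → (a + k) * (b + k) < s →
      (a + k).choose k * (b + k).choose k ≤ (a + k) * (b + k)) :
    SatisfiesG (minorsIdeal t (genericMatrix K α β)) s := by
  intro p hp hI hdim
  obtain ⟨r, k, rfl, hk, hmu, hle⟩ := exists_mu_le_and_le_ringKrullDim p hI
  rw [hα, hβ, show r + k + a - r = a + k by omega, show r + k + b - r = b + k by omega] at hmu hle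
  have hlt : (a + k) * (b + k) ≤ s - 1 := by exact_mod_cast hle.trans hdim
  exact le_trans (by exact_mod_cast hmu.trans (h k hk (by omega))) hle

/-- `G_s` fails for the `t`-minors as soon as the numerical inequality fails at some rank stratum
of codimension less than `s`. -/
theorem not_satisfiesG_minorsIdeal {t a b s k : ℕ} (hα : Fintype.card α = t + a)
    (hβ : Fintype.card β = t + b) (hk : 1 ≤ k) (hkt : k ≤ t) (hs : (a + k) * (b + k) < s)
    (h : (a + k) * (b + k) < (a + k).choose k * (b + k).choose k) :
    ¬ SatisfiesG (minorsIdeal t (genericMatrix K α β)) s := by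
  intro hG
  obtain ⟨r, rfl⟩ := Nat.exists_eq_add_of_le' hkt
  obtain ⟨p, hp, hI, hmu, hdim⟩ := exists_prime_le_mu_and_ringKrullDim_le (K := K) (α := α)
    (β := β) (r := r) hk (by omega) (by omega)
  rw [hα, hβ, show r + k + a - r = a + k by omega, show r + k + b - r = b + k by omega] at hmu hdim
  have h1 := (hG p hp hI (hdim.trans (by exact_mod_cast Nat.le_sub_one_of_lt hs))).trans hdim
  have h2 : mu ((minorsIdeal (r + k) (genericMatrix K α β)).map
    (algebraMap _ (Localization.AtPrime p))) ≤ (a + k) * (b + k) := by exact_mod_cast h1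
  omega

end Main

theorem lt_choose_two_mul_choose_two {a b : ℕ} (h : 4 < (a + 1) * (b + 1)) :
    (a + 2) * (b + 2) < (a + 2).choose 2 * (b + 2).choose 2 := by
  have h1 : ∀ c : ℕ, (c + 2).choose 2 * 2 = (c + 2) * (c + 1) := fun c => by
    rw [Nat.choose_two_right, Nat.div_mul_cancel (Nat.even_mul_pred_self _).two_dvd]
    rfl
  have h2 : (a + 2).choose 2 * (b + 2).choose 2 * 4 =
      (a + 2) * (b + 2) * ((a + 1) * (b + 1)) := by
    linear_combination (b + 2).choose 2 * 2 * h1 a + (a + 2) * (a + 1) * h1 b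
  have h3 := Nat.mul_lt_mul_of_pos_left h (show 0 < (a + 2) * (b + 2) by positivity)
  omega

theorem statement_5 (K : Type*) [Field K]
    (t m n : ℕ) (h1t : 1 ≤ t) (htm : t ≤ m) (hmn : m ≤ n)
    (hnone : ¬ (t = 1 ∨ (t = m ∧ m = n) ∨ (m = n ∧ t = n - 1) ∨ (n = m + 1 ∧ t = m) ∨
      (n = m + 2 ∧ t = m) ∨ (m = 2 ∧ n = 5 ∧ t = 2))) :
    let X : Matrix (Fin m) (Fin n) (MvPolynomial (Fin m × Fin n) K) :=
      Matrix.of fun i j => MvPolynomial.X (i, j)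
    let I := minorsIdeal t X
    ((3 ≤ t ∧ t = m ∧ n = m + 3) → (SatisfiesG I 18 ∧ ¬ SatisfiesG I 19)) ∧
    (¬ (3 ≤ t ∧ t = m ∧ n = m + 3) →
      (SatisfiesG I ((m - t + 2) * (n - t + 2)) ∧
        ¬ SatisfiesG I ((m - t + 2) * (n - t + 2) + 1))) := by
  intro X I
  obtain ⟨a, rfl⟩ := Nat.exists_eq_add_of_le htm
  obtain ⟨b, rfl⟩ := Nat.exists_eq_add_of_le (htm.trans hmn)
  have hα : Fintype.card (Fin (t + a)) = t + a := Fintype.card_fin _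
  have hβ : Fintype.card (Fin (t + b)) = t + b := Fintype.card_fin _
  have hsmall : ∀ k, 1 ≤ k → k < 2 →
      (a + k).choose k * (b + k).choose k ≤ (a + k) * (b + k) := by
    intro k h1 h2
    obtain rfl : k = 1 := by omega
    simp
  constructor
  · rintro ⟨ht, hta, htb⟩
    obtain rfl : a = 0 := by omega
    obtain rfl : b = 3 := by omega
    refine ⟨satisfiesG_minorsIdeal hα hβ (by norm_num) fun k hk hlt => ?_,
      not_satisfiesG_minorsIdeal (k := 3) hα hβ (by norm_num) ht (by norm_num) (by decide)⟩
    have : k < 3 := by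
      by_contra! hk3
      nlinarith
    interval_cases k <;> decide
  · intro hne
    rw [show t + a - t = a by omega, show t + b - t = b by omega]
    refine ⟨satisfiesG_minorsIdeal hα hβ (by nlinarith) fun k hk hlt => hsmall k hk ?_,
      not_satisfiesG_minorsIdeal (k := 2) hα hβ (by norm_num) (by omega) (by omega)
        (lt_choose_two_mul_choose_two ?_)⟩
    · by_contra! hk2
      exact absurd (Nat.mul_le_mul (Nat.add_le_add_left hk2 a) (Nat.add_le_add_left hk2 b))
        (by omega)
    · by_contra! h4
      have hab : a ≤ b := by omega
      have ha : a ≤ 1 := by nlinarith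
      have hb : b ≤ 3 := by nlinarith
      interval_cases a <;> interval_cases b <;> omega
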